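/- Adversarial error tolerance of the Generalized PolyDot feedforward stage (Theorem 4, Generalized PolyDot row with u = v^n, Error Model 1): let P ≥ m·n + n − 1 and let t be a nonnegative integer with 2t ≤ P − (m·n + n − 1). Let b_0,…,b_{P−1} be pairwise distinct real numbers, and let z_0,…,z_{P−1} ∈ ℝ^a be observed outputs. If (W, x) and (W′, x′) are two pairs of block data whose encoded product polynomials s̃ and s̃′ satisfy |{p : s̃(b_p) ≠ z_p}| ≤ t and |{p : s̃′(b_p) ≠ z_p}| ≤ t, then ∑_{j=0}^{n−1} W_{i,j} x_j = ∑_{j=0}^{n−1} W′_{i,j} x′_j for every i = 0,…,m−1. In particular, with P nodes the strategy tolerates up to ⌊(P − m·n − n + 1)/2⌋ erroneous node outputs in the feedforward stage. -/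

import Mathlib

open Polynomial Matrix BigOperators

/-- Generalized PolyDot encoding of the block matrix `W` (after substitution `u = v^n`). -/
noncomputable def gpWTilde (m n a b : ℕ) (W : Fin m → Fin n → Matrix (Fin a) (Fin b) ℝ) :
    Matrix (Fin a) (Fin b) (Polynomial ℝ) :=
  Matrix.of fun r c => ∑ i : Fin m, ∑ j : Fin n,
    Polynomial.C (W i j r c) * Polynomial.X ^ (n * (i : ℕ) + (j : ℕ))

/-- Generalized PolyDot encoding of the partitioned vector `x`. -/
noncomputable def gpXTilde (n b : ℕ) (x : Fin n → Fin b → ℝ) : Fin b → Polynomial ℝ :=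
  fun c => ∑ j : Fin n, Polynomial.C (x j c) * Polynomial.X ^ (n - 1 - (j : ℕ))

/-- The product polynomial vector `s̃(v) = W̃(v) · x̃(v)`. -/
noncomputable def gpSTilde (m n a b : ℕ) (W : Fin m → Fin n → Matrix (Fin a) (Fin b) ℝ)
    (x : Fin n → Fin b → ℝ) : Fin a → Polynomial ℝ :=
  Matrix.mulVec (gpWTilde m n a b W) (gpXTilde n b x)


theorem gp_expand (m n a b : ℕ) (W : Fin m → Fin n → Matrix (Fin a) (Fin b) ℝ)
    (x : Fin n → Fin b → ℝ) (r : Fin a) :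
    gpSTilde m n a b W x r = ∑ c : Fin b, ∑ i : Fin m, ∑ j : Fin n, ∑ k : Fin n,
      Polynomial.monomial (n * (i : ℕ) + (j : ℕ) + (n - 1 - (k : ℕ))) (W i j r c * x k c) := by
  simp only [gpSTilde, gpWTilde, gpXTilde, Matrix.mulVec, dotProduct, Matrix.of_apply,
    Finset.sum_mul, Finset.mul_sum, Polynomial.C_mul_X_pow_eq_monomial,
    Polynomial.monomial_mul_monomial]
  refine Finset.sum_congr rfl fun c _ => ?_
  rw [Finset.sum_comm]
  refine Finset.sum_congr rfl fun i _ => ?_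
  rw [Finset.sum_comm]

theorem gp_degree (m n a b : ℕ) (W : Fin m → Fin n → Matrix (Fin a) (Fin b) ℝ)
    (x : Fin n → Fin b → ℝ) (r : Fin a) :
    gpSTilde m n a b W x r ∈ Polynomial.degreeLT ℝ (m * n + n - 1) := by
  rw [gp_expand]
  refine Submodule.sum_mem _ fun c _ => Submodule.sum_mem _ fun i _ =>
    Submodule.sum_mem _ fun j _ => Submodule.sum_mem _ fun k _ => ?_
  rw [Polynomial.mem_degreeLT]
  refine lt_of_le_of_lt (Polynomial.degree_monomial_le _ _) ?_
  have hi : n * ((i : ℕ) + 1) ≤ n * m := Nat.mul_le_mul_left n i.2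
  have hj := j.2
  have hk := k.2
  rw [Nat.mul_comm n m, Nat.mul_add] at hi
  have : n * (i : ℕ) + (j : ℕ) + (n - 1 - (k : ℕ)) < m * n + n - 1 := by omega
  exact_mod_cast this

theorem gp_idx (n i i' j k : ℕ) (hj : j < n) (hk : k < n) :
    n * i' + j + (n - 1 - k) = n * i + (n - 1) ↔ i' = i ∧ j = k := by
  constructor
  · intro h
    have h1 : j + n * i' = k + n * i := by omega
    have h2 := congrArg (· % n) h1
    simp only [Nat.add_mul_mod_self_left, Nat.mod_eq_of_lt hj, Nat.mod_eq_of_lt hk] at h2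
    subst h2
    exact ⟨Nat.eq_of_mul_eq_mul_left (by omega) (Nat.add_left_cancel h1), rfl⟩
  · rintro ⟨rfl, rfl⟩
    omega

theorem gp_coeff (m n a b : ℕ) (W : Fin m → Fin n → Matrix (Fin a) (Fin b) ℝ)
    (x : Fin n → Fin b → ℝ) (r : Fin a) (i : Fin m) :
    (gpSTilde m n a b W x r).coeff (n * (i : ℕ) + (n - 1))
      = (∑ j : Fin n, Matrix.mulVec (W i j) (x j)) r := by
  rw [gp_expand]
  simp only [Polynomial.finsetSum_coeff, Polynomial.coeff_monomial]
  have : ∀ (c : Fin b) (i' : Fin m) (j k : Fin n),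
      (if n * (i' : ℕ) + (j : ℕ) + (n - 1 - (k : ℕ)) = n * (i : ℕ) + (n - 1)
        then W i' j r c * x k c else 0)
      = if i' = i then (if j = k then W i' j r c * x k c else 0) else 0 := by
    intro c i' j k
    simp only [gp_idx n i i' j k j.2 k.2, Fin.val_inj, ite_and]
  simp only [this]
  have h2 : ∀ c : Fin b, (∑ i' : Fin m, ∑ j : Fin n, ∑ k : Fin n,
      if i' = i then (if j = k then W i' j r c * x k c else 0) else 0)
      = ∑ j : Fin n, W i j r c * x j c := by
    intro c
    rw [Finset.sum_eq_single i]
    · simp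
    · intro i' _ h
      simp [h]
    · simp
  simp only [h2, Finset.sum_apply, Matrix.mulVec, dotProduct]
  exact Finset.sum_comm

/-- Adversarial error tolerance of the Generalized PolyDot feedforward stage (Theorem 4,
Error Model 1, substitution `u = v^n`): with `P` nodes and `2t ≤ P − (m·n + n − 1)`, the
desired products are determined even when up to `t` node outputs are arbitrarily corrupted. -/
theorem stmt_15 (m n a b P t : ℕ) (hm : 0 < m) (hn : 0 < n) (ha : 0 < a) (hb : 0 < b)
    (hP : m * n + n - 1 ≤ P) (ht : 2 * t ≤ P - (m * n + n - 1))
    (bp : Fin P → ℝ) (hbp : Function.Injective bp) (z : Fin P → Fin a → ℝ)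
    (W W' : Fin m → Fin n → Matrix (Fin a) (Fin b) ℝ) (x x' : Fin n → Fin b → ℝ)
    (hz : (Finset.univ.filter fun p : Fin P =>
      (fun r : Fin a => (gpSTilde m n a b W x r).eval (bp p)) ≠ z p).card ≤ t)
    (hz' : (Finset.univ.filter fun p : Fin P =>
      (fun r : Fin a => (gpSTilde m n a b W' x' r).eval (bp p)) ≠ z p).card ≤ t) :
    ∀ i : Fin m,
      (∑ j : Fin n, Matrix.mulVec (W i j) (x j))
        = ∑ j : Fin n, Matrix.mulVec (W' i j) (x' j) := by
  intro i
  funext r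
  rw [← gp_coeff, ← gp_coeff]
  congr 1
  classical
  set A := Finset.univ.filter fun p : Fin P =>
      (fun r : Fin a => (gpSTilde m n a b W x r).eval (bp p)) ≠ z p with hA
  set B := Finset.univ.filter fun p : Fin P =>
      (fun r : Fin a => (gpSTilde m n a b W' x' r).eval (bp p)) ≠ z p with hB
  have hc : m * n + n - 1 ≤ ((A ∪ B)ᶜ).card := by
    have h1 := Finset.card_union_le A B
    rw [Finset.card_compl, Fintype.card_fin]
    omega
  have hd := (Polynomial.degreeLT ℝ (m * n + n - 1)).sub_mem
    (gp_degree m n a b W x r) (gp_degree m n a b W' x' r)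
  rw [Polynomial.mem_degreeLT] at hd
  refine sub_eq_zero.mp (Polynomial.eq_zero_of_degree_lt_of_eval_index_eq_zero
    (s := (A ∪ B)ᶜ) (v := bp) hbp.injOn (lt_of_lt_of_le hd (by exact_mod_cast hc)) ?_)
  intro p hp
  simp only [hA, hB, Finset.mem_compl, Finset.mem_union, Finset.mem_filter, Finset.mem_univ,
    true_and, not_or, not_not] at hp
  have := congrFun (hp.1.trans hp.2.symm) r
  simpa [sub_eq_zero] using this
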